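/- Let μ₁ and μ₂ be invariant probability measures of a Markov kernel P on a metric space (E, d) with Borel σ-field 𝓔. Assume there exists M ∈ 𝓔 ⊗ 𝓔 with (μ₁ ⊗ μ₂)(M) > 0 such that for every (x, y) ∈ M there exists α_{x,y} > 0 such that for every ε > 0 there exists a generalized coupling ξ^ε_{x,y} ∈ Ĉ(ℙ_x, ℙ_y) satisfying (ξ^ε_{x,y})*( { (ξ, η) ∈ E^{ℕ₀} × E^{ℕ₀} : limsup_{n→∞} (1/n) ∑_{i=0}^{n−1} 𝟙_{[0,ε]}(d(ξ_i, η_i)) ≥ α_{x,y} } ) > 0, where (ξ^ε_{x,y})* denotes the outer measure associated with ξ^ε_{x,y}. Then μ₁ and μ₂ are not mutually singular. -/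

import Mathlib

open MeasureTheory ProbabilityTheory Filter

/-- `μ` is an invariant probability measure of the Markov kernel `P`. -/
def IsInvariantMeasure {E : Type*} [MeasurableSpace E] (P : Kernel E E)
    (μ : Measure E) : Prop :=
  ∀ A : Set E, MeasurableSet A → μ A = ∫⁻ x, P x A ∂μ

/-- Prepend a point to a trajectory. -/
def consTraj {E : Type*} (x : E) (ω : ℕ → E) : ℕ → E :=
  fun n => Nat.casesOn n x ω

/-- `ℙP : E → Measure (ℕ → E)` is the family of laws of the Markov chain with
kernel `P`. -/
def IsChainLaw {E : Type*} [MeasurableSpace E] (P : Kernel E E)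
    (ℙP : E → Measure (ℕ → E)) : Prop :=
  (∀ x, IsProbabilityMeasure (ℙP x)) ∧
    ∀ x, ℙP x = (P x).bind (fun y => (ℙP y).map (consTraj x))

/-- `ξ` is a generalized coupling of `ℙx` and `ℙy`: a probability measure on
pairs of trajectories whose marginals are absolutely continuous with respect to
`ℙx` and `ℙy` respectively. -/
def IsGeneralizedCoupling {E : Type*} [MeasurableSpace E]
    (ξ : Measure ((ℕ → E) × (ℕ → E))) (ℙx ℙy : Measure (ℕ → E)) : Prop :=
  IsProbabilityMeasure ξ ∧ ξ.map Prod.fst ≪ ℙx ∧ ξ.map Prod.snd ≪ ℙy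

open scoped symmDiff ENNReal

section helpers

variable {E : Type*} [MeasurableSpace E]

/-- The shift on trajectories. -/
def shiftTraj (ω : ℕ → E) : ℕ → E := fun n => ω (n + 1)

lemma measurable_shiftTraj : Measurable (shiftTraj (E := E)) :=
  measurable_pi_lambda _ fun n => measurable_pi_apply (n + 1)

lemma measurable_consTraj (x : E) : Measurable (consTraj x) := by
  refine measurable_pi_lambda _ fun n => ?_
  cases n with
  | zero => exact measurable_const
  | succ n => exact measurable_pi_apply n

lemma shiftTraj_consTraj (x : E) (ω : ℕ → E) : shiftTraj (consTraj x ω) = ω := rfl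

lemma chainLaw_aemeasurable {P : Kernel E E} {Q : E → Measure (ℕ → E)} (hQ : IsChainLaw P Q)
    (x : E) : AEMeasurable (fun y => (Q y).map (consTraj x)) (P x) := by
  by_contra h
  have h1 := hQ.2 x
  rw [Measure.bind, Measure.map_of_not_aemeasurable h, Measure.join_zero] at h1
  have := hQ.1 x
  exact IsProbabilityMeasure.ne_zero _ h1

lemma chainLaw_apply {P : Kernel E E} {Q : E → Measure (ℕ → E)} (hQ : IsChainLaw P Q)
    (x : E) {A : Set (ℕ → E)} (hA : MeasurableSet A) :
    Q x A = ∫⁻ y, Q y (consTraj x ⁻¹' A) ∂(P x) := by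
  conv_lhs => rw [hQ.2 x]
  rw [Measure.bind_apply hA (chainLaw_aemeasurable hQ x)]
  refine lintegral_congr fun y => ?_
  rw [Measure.map_apply (measurable_consTraj x) hA]

lemma chainLaw_box {P : Kernel E E} [IsMarkovKernel P] {Q : E → Measure (ℕ → E)}
    (hQ : IsChainLaw P Q) (n : ℕ) : ∀ S : ℕ → Set E, (∀ i, MeasurableSet (S i)) →
      Measurable fun x => Q x {ω | ∀ i < n, ω i ∈ S i} := by
  have := hQ.1
  induction n with
  | zero => intro S hS; simp
  | succ n ih =>
    intro S hS
    have hm : MeasurableSet {ω : ℕ → E | ∀ i < n + 1, ω i ∈ S i} := by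
      simp only [Set.ofPred_forall]
      exact MeasurableSet.iInter fun i => MeasurableSet.iInter fun _ =>
        measurable_pi_apply i (hS i)
    have h1 : (fun x => Q x {ω | ∀ i < n + 1, ω i ∈ S i}) =
        (S 0).indicator (fun x => ∫⁻ y, Q y {ω | ∀ i < n, ω i ∈ S (i + 1)} ∂(P x)) := by
      funext x
      rw [chainLaw_apply hQ x hm]
      by_cases hx : x ∈ S 0
      · rw [Set.indicator_of_mem hx]
        refine lintegral_congr fun y => ?_
        congr 1
        ext ω
        constructor
        · intro h i hi
          exact h (i + 1) (by omega)
        · intro h i hi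
          cases i with
          | zero => exact hx
          | succ i => exact h i (by omega)
      · rw [Set.indicator_of_notMem hx]
        have : consTraj x ⁻¹' {ω : ℕ → E | ∀ i < n + 1, ω i ∈ S i} = ∅ := by
          ext ω
          simp only [Set.mem_empty_iff_false, iff_false]
          intro h
          exact hx (h 0 (by omega))
        simp only [this, measure_empty, lintegral_zero]
    rw [h1]
    refine Measurable.indicator ?_ (hS 0)
    exact (ih (fun i => S (i + 1)) fun i => hS _).lintegral_kernel

lemma chainLaw_measurable {P : Kernel E E} [IsMarkovKernel P] {Q : E → Measure (ℕ → E)}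
    (hQ : IsChainLaw P Q) : Measurable Q := by
  classical
  have := hQ.1
  refine Measurable.measure_of_isPiSystem_of_isProbabilityMeasure
    (generateFrom_squareCylinders (α := fun _ : ℕ => E)).symm
    (isPiSystem_squareCylinders (fun i => MeasurableSpace.isPiSystem_measurableSet)
      (fun i => MeasurableSet.univ)) ?_
  rintro A ⟨s, t, ht, rfl⟩
  have h := chainLaw_box hQ (s.sup id + 1) (fun i => if i ∈ s then t i else Set.univ) (by
    intro i
    split_ifs
    · exact ht i trivial
    · exact MeasurableSet.univ)
  convert h using 3 with x
  ext ω
  constructor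
  · intro h i hi
    beta_reduce
    split_ifs with h'
    · exact h i h'
    · trivial
  · intro h i hi
    have h2 := h i (Nat.lt_succ_of_le (Finset.le_sup (f := id) hi))
    have h3 : i ∈ s := hi
    simpa [h3] using h2

lemma chainLaw_zero {P : Kernel E E} [IsMarkovKernel P] {Q : E → Measure (ℕ → E)}
    (hQ : IsChainLaw P Q) (x : E) {B : Set E} (hB : MeasurableSet B) :
    Q x {ω | ω 0 ∈ B} = B.indicator 1 x := by
  have := hQ.1
  have hm : MeasurableSet {ω : ℕ → E | ω 0 ∈ B} := measurable_pi_apply 0 hB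
  rw [chainLaw_apply hQ x hm]
  by_cases hx : x ∈ B
  · have : consTraj x ⁻¹' {ω : ℕ → E | ω 0 ∈ B} = Set.univ := by
      ext ω; simpa [consTraj] using hx
    simp [this, hx]
  · have : consTraj x ⁻¹' {ω : ℕ → E | ω 0 ∈ B} = ∅ := by
      ext ω; simpa [consTraj] using hx
    simp [this, hx]

lemma chainLaw_lintegral {P : Kernel E E} [IsMarkovKernel P] {Q : E → Measure (ℕ → E)}
    (hQ : IsChainLaw P Q) (x : E) {f : (ℕ → E) → ℝ≥0∞} (hf : Measurable f) :
    ∫⁻ ω, f ω ∂(Q x) = ∫⁻ y, ∫⁻ ω, f (consTraj x ω) ∂(Q y) ∂(P x) := by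
  conv_lhs => rw [hQ.2 x]
  rw [Measure.lintegral_bind (chainLaw_aemeasurable hQ x) hf.aemeasurable]
  refine lintegral_congr fun y => ?_
  rw [lintegral_map hf (measurable_consTraj x)]

/-- Stationary law. -/
lemma bind_chainLaw_shift {P : Kernel E E} [IsMarkovKernel P] {Q : E → Measure (ℕ → E)}
    (hQ : IsChainLaw P Q) {μ : Measure E} (hμ : IsInvariantMeasure P μ) :
    MeasurePreserving (shiftTraj (E := E)) (μ.bind Q) (μ.bind Q) := by
  refine ⟨measurable_shiftTraj, ?_⟩
  have hm := chainLaw_measurable hQ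
  have hμ' : μ.bind P = μ := by
    ext A hA
    rw [Measure.bind_apply hA P.measurable.aemeasurable, hμ A hA]
  have hb : Measurable fun a => (P a).bind Q := (Measure.measurable_bind' hm).comp P.measurable
  ext A hA
  rw [Measure.map_apply measurable_shiftTraj hA,
    Measure.bind_apply (measurable_shiftTraj hA) hm.aemeasurable]
  conv_rhs => rw [← hμ']
  rw [Measure.bind_bind P.measurable.aemeasurable hm.aemeasurable,
    Measure.bind_apply hA hb.aemeasurable]
  refine lintegral_congr fun x => ?_
  rw [chainLaw_apply hQ x (measurable_shiftTraj hA), Measure.bind_apply hA hm.aemeasurable]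
  rfl

/-- Markov property for invariant events. -/
lemma chainLaw_markov {P : Kernel E E} [IsMarkovKernel P] {Q : E → Measure (ℕ → E)}
    (hQ : IsChainLaw P Q) {F : Set (ℕ → E)} (hF : MeasurableSet F)
    (hinv : ∀ ω, shiftTraj ω ∈ F ↔ ω ∈ F) (n : ℕ) :
    ∀ G : Set (ℕ → E), MeasurableSet G →
      (∀ ω ω' : ℕ → E, (∀ i ≤ n, ω i = ω' i) → ω ∈ G → ω' ∈ G) → ∀ x,
      Q x (G ∩ F) = ∫⁻ ω, G.indicator (fun ω => Q (ω n) F) ω ∂(Q x) := by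
  have := hQ.1
  have hm := chainLaw_measurable hQ
  have hu : Measurable fun x => Q x F := Measure.measurable_coe hF |>.comp hm
  have hcons : ∀ x, consTraj x ⁻¹' F = F := fun x => by
    ext ω
    rw [Set.mem_preimage, ← hinv, shiftTraj_consTraj]
  induction n with
  | zero =>
    intro G hG hdep x
    have hg : Measurable (G.indicator (fun ω => Q (ω 0) F)) :=
      (hu.comp (measurable_pi_apply 0)).indicator hG
    rw [chainLaw_apply hQ x (hG.inter hF), chainLaw_lintegral hQ x hg]
    by_cases hx : ∃ ω, consTraj x ω ∈ G
    · obtain ⟨ω₀, h₀⟩ := hx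
      have hall : ∀ ω, consTraj x ω ∈ G := fun ω => hdep _ _ (by
        intro i hi
        obtain rfl : i = 0 := by omega
        rfl) h₀
      have h1 : consTraj x ⁻¹' (G ∩ F) = F := by
        rw [Set.preimage_inter, hcons]
        ext ω; simp [hall]
      have h2 : ∀ ω, G.indicator (fun ω => Q (ω 0) F) (consTraj x ω) = Q x F := fun ω => by
        rw [Set.indicator_of_mem (hall ω)]; rfl
      simp only [h1, h2]
      have := chainLaw_apply hQ x hF
      rw [hcons] at this
      rw [← this]
      simp
    · push Not at hx
      have h1 : consTraj x ⁻¹' (G ∩ F) = ∅ := by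
        ext ω; simp [hx]
      simp [h1, hx]
  | succ n ih =>
    intro G hG hdep x
    have hg : Measurable (G.indicator (fun ω => Q (ω (n + 1)) F)) :=
      (hu.comp (measurable_pi_apply (n + 1))).indicator hG
    rw [chainLaw_apply hQ x (hG.inter hF), chainLaw_lintegral hQ x hg]
    refine lintegral_congr fun y => ?_
    rw [Set.preimage_inter, hcons]
    rw [ih (consTraj x ⁻¹' G) (measurable_consTraj x hG) ?_ y]
    · rfl
    · intro ω ω' h hω
      refine hdep _ _ ?_ hω
      intro i hi
      cases i with
      | zero => rfl
      | succ i => exact h i (by omega)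

/-- `0`-`1` law. -/
lemma chainLaw_zero_one {P : Kernel E E} [IsMarkovKernel P] {Q : E → Measure (ℕ → E)}
    (hQ : IsChainLaw P Q) {μ : Measure E} [IsProbabilityMeasure μ] (hμ : IsInvariantMeasure P μ)
    {F : Set (ℕ → E)} (hF : MeasurableSet F)
    (hinv : ∀ ω, shiftTraj ω ∈ F ↔ ω ∈ F) :
    ∀ᵐ x ∂μ, Q x F = 0 ∨ Q x F = 1 := by
  have := hQ.1
  have hm := chainLaw_measurable hQ
  have hu : Measurable fun x => Q x F := Measure.measurable_coe hF |>.comp hm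
  have hν : IsProbabilityMeasure (μ.bind Q) := ⟨by
    rw [Measure.bind_apply MeasurableSet.univ hm.aemeasurable]; simp⟩
  have hFc : MeasurableSet Fᶜ := hF.compl
  have hinvc : ∀ ω, shiftTraj ω ∈ Fᶜ ↔ ω ∈ Fᶜ := fun ω => not_congr (hinv ω)
  have huc : Measurable fun x => Q x Fᶜ := Measure.measurable_coe hFc |>.comp hm
  have hshift : ∀ n, (μ.bind Q).map (fun ω => ω n) = μ := by
    intro n
    induction n with
    | zero =>
      ext B hB
      rw [Measure.map_apply (measurable_pi_apply 0) hB,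
        Measure.bind_apply (measurable_pi_apply 0 hB) hm.aemeasurable]
      have : ∀ x, Q x ((fun ω : ℕ → E => ω 0) ⁻¹' B) = B.indicator 1 x := fun x =>
        chainLaw_zero hQ x hB
      simp only [this]
      simp [lintegral_indicator, hB]
    | succ n ih =>
      conv_rhs => rw [← ih, ← (bind_chainLaw_shift hQ hμ).map_eq]
      rw [Measure.map_map (measurable_pi_apply n) measurable_shiftTraj]
      rfl
  have markov : ∀ (F : Set (ℕ → E)), MeasurableSet F → (∀ ω, shiftTraj ω ∈ F ↔ ω ∈ F) →
      ∀ (n : ℕ) (G : Set (ℕ → E)), MeasurableSet G →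
      (∀ ω ω' : ℕ → E, (∀ i ≤ n, ω i = ω' i) → ω ∈ G → ω' ∈ G) →
      (μ.bind Q) (G ∩ F) = ∫⁻ ω, G.indicator (fun ω => Q (ω n) F) ω ∂(μ.bind Q) := by
    intro F hF hinv n G hG hdep
    have hu : Measurable fun x => Q x F := Measure.measurable_coe hF |>.comp hm
    have hg : Measurable (G.indicator (fun ω => Q (ω n) F)) :=
      (hu.comp (measurable_pi_apply n)).indicator hG
    rw [Measure.bind_apply (hG.inter hF) hm.aemeasurable, Measure.lintegral_bind hm.aemeasurable
      hg.aemeasurable]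
    exact lintegral_congr fun x => chainLaw_markov hQ hF hinv n G hG hdep x
  have key : ∫⁻ x, min (Q x F) (Q x Fᶜ) ∂μ = 0 := by
    by_contra hne
    obtain ⟨t, htC, ht⟩ := exists_measure_symmDiff_lt_of_generateFrom_isSetRing (μ := μ.bind Q)
      (isSetRing_measurableCylinders (α := fun _ : ℕ => E))
      ⟨{Set.univ}, Set.countable_singleton _, by
        simpa using univ_mem_measurableCylinders (fun _ : ℕ => E), by simp⟩
      generateFrom_measurableCylinders.symm hF (pos_iff_ne_zero.2 hne)
    have htm : MeasurableSet t := MeasurableSet.of_mem_measurableCylinders htC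
    rw [measurableCylinders_nat] at htC
    simp only [Set.mem_iUnion, Set.mem_singleton_iff] at htC
    obtain ⟨n, S, hS, rfl⟩ := htC
    have hdep : ∀ ω ω' : ℕ → E, (∀ i ≤ n, ω i = ω' i) →
        ω ∈ cylinder (α := fun _ : ℕ => E) (Finset.Iic n) S →
        ω' ∈ cylinder (α := fun _ : ℕ => E) (Finset.Iic n) S := by
      intro ω ω' h hω
      rw [mem_cylinder] at hω ⊢
      convert hω using 1
      funext i
      exact (h i (Finset.mem_Iic.1 i.2)).symm
    generalize cylinder (α := fun _ : ℕ => E) (Finset.Iic n) S = G at *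
    have e1 := markov F hF hinv n Gᶜ htm.compl fun ω ω' h hω hω' =>
      hω (hdep ω' ω (fun i hi => (h i hi).symm) hω')
    have e2 := markov Fᶜ hFc hinvc n G htm hdep
    have e3 : ∫⁻ x, min (Q x F) (Q x Fᶜ) ∂μ =
        ∫⁻ ω, min (Q (ω n) F) (Q (ω n) Fᶜ) ∂(μ.bind Q) := by
      conv_lhs => rw [← hshift n]
      rw [lintegral_map (hu.min huc) (measurable_pi_apply n)]
    have e4 : ∫⁻ ω, min (Q (ω n) F) (Q (ω n) Fᶜ) ∂(μ.bind Q) ≤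
        (μ.bind Q) (Gᶜ ∩ F) + (μ.bind Q) (G ∩ Fᶜ) := by
      have hg : Measurable (Gᶜ.indicator (fun ω => Q (ω n) F)) :=
        (hu.comp (measurable_pi_apply n)).indicator htm.compl
      rw [e1, e2, ← lintegral_add_left hg]
      refine lintegral_mono fun ω => ?_
      by_cases hω : ω ∈ G
      · simp [hω]
      · simp [hω]
    have e5 : (μ.bind Q) (Gᶜ ∩ F) + (μ.bind Q) (G ∩ Fᶜ) = (μ.bind Q) (G ∆ F) := by
      rw [measure_symmDiff_eq htm.nullMeasurableSet hF.nullMeasurableSet, add_comm,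
        Set.sdiff_eq, Set.sdiff_eq, Set.inter_comm Gᶜ]
    rw [e3] at ht
    exact absurd (e4.trans_eq e5) (not_le.2 ht)
  rw [lintegral_eq_zero_iff (hu.min huc)] at key
  filter_upwards [key] with x hx
  have hx : min (Q x F) (Q x Fᶜ) = 0 := hx
  rcases min_choice (Q x F) (Q x Fᶜ) with h | h
  · left; rw [← h, hx]
  · right
    exact (prob_compl_eq_zero_iff hF).1 (by rw [← h, hx])


/-- Number of visits to `D` before time `n`. -/
noncomputable def visits (D : Set E) (n : ℕ) (ω : ℕ → E) : ℝ :=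
  ∑ i ∈ Finset.range n, D.indicator (fun _ => (1 : ℝ)) (ω i)

lemma visits_succ (D : Set E) (n : ℕ) (ω : ℕ → E) :
    visits D (n + 1) ω = D.indicator (fun _ => (1 : ℝ)) (ω 0) + visits D n (shiftTraj ω) := by
  unfold visits
  rw [Finset.sum_range_succ', add_comm]
  rfl

lemma measurable_visits {D : Set E} (hD : MeasurableSet D) (n : ℕ) :
    Measurable (visits D n) := by
  unfold visits
  exact Finset.measurable_sum _ fun i _ =>
    (measurable_const.indicator hD).comp (measurable_pi_apply i)

lemma ind_nonneg (D : Set E) (x : E) : 0 ≤ D.indicator (fun _ => (1 : ℝ)) x :=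
  Set.indicator_nonneg (fun _ _ => zero_le_one) x

lemma ind_le_one (D : Set E) (x : E) : D.indicator (fun _ => (1 : ℝ)) x ≤ 1 :=
  Set.indicator_le_self' (fun _ _ => zero_le_one) x

/-- Trajectories visiting `D` too often. -/
def badTraj (D : Set E) (c : ℝ) : Set (ℕ → E) :=
  {ω | ∀ K : ℕ, ∃ n : ℕ, c * n + K < visits D n ω}

lemma measurableSet_badTraj {D : Set E} (hD : MeasurableSet D) (c : ℝ) :
    MeasurableSet (badTraj D c) := by
  have : badTraj D c = ⋂ K : ℕ, ⋃ n : ℕ, {ω | c * n + K < visits D n ω} := by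
    ext ω; simp [badTraj]
  rw [this]
  exact MeasurableSet.iInter fun K => MeasurableSet.iUnion fun n =>
    measurableSet_lt measurable_const (measurable_visits hD n)

lemma badTraj_inv (D : Set E) {c : ℝ} (hc : 0 < c) (ω : ℕ → E) :
    shiftTraj ω ∈ badTraj D c ↔ ω ∈ badTraj D c := by
  constructor
  · intro h K
    obtain ⟨k, hk⟩ := exists_nat_ge c
    obtain ⟨n, hn⟩ := h (K + k)
    refine ⟨n + 1, ?_⟩
    rw [visits_succ]
    push_cast at hn ⊢
    linarith [ind_nonneg D (ω 0)]
  · intro h K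
    obtain ⟨n, hn⟩ := h (K + 1)
    cases n with
    | zero =>
      simp [visits] at hn
      have : (0 : ℝ) ≤ K := Nat.cast_nonneg K
      linarith
    | succ n =>
      refine ⟨n, ?_⟩
      rw [visits_succ] at hn
      push_cast at hn
      linarith [ind_le_one D (ω 0)]

/-- Running maximum of the centred visit counts. -/
noncomputable def maxFn (D : Set E) (c : ℝ) : ℕ → (ℕ → E) → ℝ
  | 0, _ => 0
  | n + 1, ω => max 0 (D.indicator (fun _ => (1 : ℝ)) (ω 0) - c + maxFn D c n (shiftTraj ω))

lemma measurable_maxFn {D : Set E} (hD : MeasurableSet D) (c : ℝ) (n : ℕ) :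
    Measurable (maxFn D c n) := by
  induction n with
  | zero => exact measurable_const
  | succ n ih =>
    have h1 : Measurable fun ω : ℕ → E => D.indicator (fun _ => (1 : ℝ)) (ω 0) :=
      (measurable_const.indicator hD).comp (measurable_pi_apply 0)
    exact measurable_const.max ((h1.sub_const c).add (ih.comp measurable_shiftTraj))

lemma maxFn_nonneg (D : Set E) (c : ℝ) (n : ℕ) (ω : ℕ → E) : 0 ≤ maxFn D c n ω := by
  cases n with
  | zero => exact le_rfl
  | succ n => exact le_max_left _ _

lemma maxFn_mono (D : Set E) (c : ℝ) (n : ℕ) :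
    ∀ ω : ℕ → E, maxFn D c n ω ≤ maxFn D c (n + 1) ω := by
  induction n with
  | zero => intro ω; exact maxFn_nonneg D c 1 ω
  | succ n ih =>
    intro ω
    exact max_le_max le_rfl (by have := ih (shiftTraj ω); linarith)

lemma maxFn_le (D : Set E) {c : ℝ} (hc : 0 < c) (n : ℕ) :
    ∀ ω : ℕ → E, maxFn D c n ω ≤ n := by
  induction n with
  | zero => intro ω; simp [maxFn]
  | succ n ih =>
    intro ω
    have h1 := ih (shiftTraj ω)
    have h2 := ind_le_one D (ω 0)
    rw [maxFn]
    push_cast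
    exact max_le (by positivity) (by linarith)

lemma visits_le_maxFn (D : Set E) (c : ℝ) (n : ℕ) :
    ∀ ω : ℕ → E, visits D n ω - c * n ≤ maxFn D c n ω := by
  induction n with
  | zero => intro ω; simp [visits, maxFn]
  | succ n ih =>
    intro ω
    refine le_trans ?_ (le_max_right _ _)
    have := ih (shiftTraj ω)
    rw [visits_succ]
    push_cast
    linarith

lemma maximal_ineq {ν : Measure (ℕ → E)} [IsProbabilityMeasure ν]
    (hT : MeasurePreserving (shiftTraj (E := E)) ν ν) {D : Set E} (hD : MeasurableSet D)
    {c : ℝ} (hc : 0 < c) (n : ℕ) :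
    c * ν.real {ω | 0 < maxFn D c n ω} ≤ ν.real {ω | ω 0 ∈ D} := by
  have hint : ∀ n, Integrable (maxFn D c n) ν := fun n =>
    Integrable.of_bound (measurable_maxFn hD c n).aestronglyMeasurable n
      (Eventually.of_forall fun ω => by
        rw [Real.norm_of_nonneg (maxFn_nonneg D c n ω)]; exact maxFn_le D hc n ω)
  cases n with
  | zero =>
    simp [maxFn]
  | succ n =>
    have hm1 : MeasurableSet {ω : ℕ → E | ω 0 ∈ D} := measurable_pi_apply 0 hD
    have hm2 : MeasurableSet {ω : ℕ → E | 0 < maxFn D c (n + 1) ω} :=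
      measurableSet_lt measurable_const (measurable_maxFn hD c (n + 1))
    have hi1 : Integrable ({ω : ℕ → E | ω 0 ∈ D}.indicator fun _ => (1 : ℝ)) ν :=
      (integrable_const _).indicator hm1
    have hi2 : Integrable ({ω : ℕ → E | 0 < maxFn D c (n + 1) ω}.indicator fun _ => c) ν :=
      (integrable_const _).indicator hm2
    have hi3 : Integrable (fun ω => maxFn D c n (shiftTraj ω)) ν :=
      hT.integrable_comp_of_integrable (hint n)
    have hpt : ∀ ω, maxFn D c (n + 1) ω - maxFn D c n (shiftTraj ω) ≤
        {ω : ℕ → E | ω 0 ∈ D}.indicator (fun _ => (1 : ℝ)) ω -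
          {ω : ℕ → E | 0 < maxFn D c (n + 1) ω}.indicator (fun _ => c) ω := by
      intro ω
      have e : {ω : ℕ → E | ω 0 ∈ D}.indicator (fun _ => (1 : ℝ)) ω =
          D.indicator (fun _ => (1 : ℝ)) (ω 0) := rfl
      rw [e]
      by_cases h : 0 < maxFn D c (n + 1) ω
      · rw [Set.indicator_of_mem (show ω ∈ {ω : ℕ → E | 0 < maxFn D c (n + 1) ω} from h)]
        have h' : maxFn D c (n + 1) ω =
          max 0 (D.indicator (fun _ => (1 : ℝ)) (ω 0) - c + maxFn D c n (shiftTraj ω)) := rfl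
        rcases max_choice 0
          (D.indicator (fun _ => (1 : ℝ)) (ω 0) - c + maxFn D c n (shiftTraj ω)) with h2 | h2
        · rw [h', h2] at h
          exact absurd h (lt_irrefl _)
        · rw [h', h2]; linarith
      · rw [Set.indicator_of_notMem (show ω ∉ {ω : ℕ → E | 0 < maxFn D c (n + 1) ω} from h)]
        linarith [ind_nonneg D (ω 0), maxFn_nonneg D c n (shiftTraj ω)]
    have h1 := integral_mono ((hint (n + 1)).sub hi3) (hi1.sub hi2) hpt
    simp only [Pi.sub_apply] at h1
    rw [integral_sub (hint (n + 1)) hi3, integral_sub hi1 hi2, integral_indicator_const _ hm1,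
      integral_indicator_const _ hm2] at h1
    have h2 : ∫ ω, maxFn D c n (shiftTraj ω) ∂ν = ∫ ω, maxFn D c n ω ∂ν := by
      conv_rhs => rw [← hT.map_eq]
      rw [integral_map measurable_shiftTraj.aemeasurable
        (measurable_maxFn hD c n).aestronglyMeasurable]
    have h3 := integral_mono (hint n) (hint (n + 1)) (maxFn_mono D c n)
    simp only [smul_eq_mul] at h1
    linarith

lemma measure_badTraj_le {ν : Measure (ℕ → E)} [IsProbabilityMeasure ν]
    (hT : MeasurePreserving (shiftTraj (E := E)) ν ν) {D : Set E} (hD : MeasurableSet D)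
    {c : ℝ} (hc : 0 < c) :
    ν (badTraj D c) ≤ ν {ω | ω 0 ∈ D} / ENNReal.ofReal c := by
  have hsub : badTraj D c ⊆ ⋃ n, {ω | 0 < maxFn D c n ω} := by
    intro ω hω
    obtain ⟨n, hn⟩ := hω 0
    refine Set.mem_iUnion.2 ⟨n, ?_⟩
    have := visits_le_maxFn D c n ω
    push_cast at hn
    change 0 < maxFn D c n ω
    linarith
  have hmono : Monotone fun n => {ω : ℕ → E | 0 < maxFn D c n ω} :=
    monotone_nat_of_le_succ fun n ω hω => lt_of_lt_of_le hω (maxFn_mono D c n ω)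
  refine (measure_mono hsub).trans ?_
  rw [hmono.measure_iUnion]
  refine iSup_le fun n => ?_
  rw [ENNReal.le_div_iff_mul_le (by simp [hc]) (by simp)]
  have h := maximal_ineq hT hD hc n
  have h2 := ENNReal.ofReal_le_ofReal h
  rw [ENNReal.ofReal_mul hc.le, ofReal_measureReal, ofReal_measureReal, mul_comm] at h2
  exact h2

lemma chainLaw_bad {P : Kernel E E} [IsMarkovKernel P] {Q : E → Measure (ℕ → E)}
    (hQ : IsChainLaw P Q) {μ : Measure E} [IsProbabilityMeasure μ] (hμ : IsInvariantMeasure P μ)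
    {D : Set E} (hD : MeasurableSet D) {c : ℝ} (hc : 0 < c) :
    μ {x | Q x (badTraj D c) ≠ 0} ≤ μ D / ENNReal.ofReal c := by
  have := hQ.1
  have hm := chainLaw_measurable hQ
  have hF := measurableSet_badTraj hD c
  have hu : Measurable fun x => Q x (badTraj D c) := Measure.measurable_coe hF |>.comp hm
  have hν : IsProbabilityMeasure (μ.bind Q) := ⟨by
    rw [Measure.bind_apply MeasurableSet.univ hm.aemeasurable]; simp⟩
  have h01 := chainLaw_zero_one hQ hμ hF (badTraj_inv D hc)
  have h1 := measure_badTraj_le (bind_chainLaw_shift hQ hμ) hD hc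
  have hD0 : MeasurableSet {ω : ℕ → E | ω 0 ∈ D} := measurable_pi_apply 0 hD
  have h2 : (μ.bind Q) {ω | ω 0 ∈ D} = μ D := by
    rw [Measure.bind_apply hD0 hm.aemeasurable]
    simp only [chainLaw_zero hQ _ hD]
    simp [lintegral_indicator, hD]
  have hne : MeasurableSet {x | Q x (badTraj D c) ≠ 0} :=
    (hu (measurableSet_singleton 0)).compl
  have h3 : (μ.bind Q) (badTraj D c) = μ {x | Q x (badTraj D c) ≠ 0} := by
    rw [Measure.bind_apply hF hm.aemeasurable, ← lintegral_indicator_one hne]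
    refine lintegral_congr_ae ?_
    filter_upwards [h01] with x hx
    rcases hx with hx | hx
    · rw [Set.indicator_of_notMem (by simpa using hx), hx]
    · rw [Set.indicator_of_mem (by simp [hx]), hx]; rfl
  rw [← h3, ← h2]
  exact h1

lemma chainLaw_ae_eventually {P : Kernel E E} [IsMarkovKernel P] {Q : E → Measure (ℕ → E)}
    (hQ : IsChainLaw P Q) {μ : Measure E} [IsProbabilityMeasure μ] (hμ : IsInvariantMeasure P μ)
    {D : ℕ → Set E} (hD : ∀ k, MeasurableSet (D k))
    (hμD : ∀ k, μ (D k) ≤ ENNReal.ofReal ((1 / 4) ^ k)) :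
    ∀ᵐ x ∂μ, ∀ᶠ k in atTop, Q x (badTraj (D k) ((1 / 2) ^ k)) = 0 := by
  have h := ae_eventually_notMem (μ := μ)
    (s := fun k => {x | Q x (badTraj (D k) ((1 / 2) ^ k)) ≠ 0}) (by
      refine ne_top_of_le_ne_top (b := ∑' k : ℕ, ENNReal.ofReal ((1 / 2) ^ k)) ?_
        (ENNReal.tsum_le_tsum fun k => ?_)
      · exact (summable_geometric_two).tsum_ofReal_ne_top
      · refine (chainLaw_bad hQ hμ (hD k) (by positivity)).trans ?_
        refine (ENNReal.div_le_div_right (hμD k) _).trans ?_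
        rw [← ENNReal.ofReal_div_of_pos (by positivity)]
        apply ENNReal.ofReal_le_ofReal
        rw [← div_pow]
        norm_num)
  filter_upwards [h] with x hx
  filter_upwards [hx] with k hk
  by_contra h
  exact hk h

end helpers

lemma exists_separation {E : Type*} [MetricSpace E] [MeasurableSpace E] [BorelSpace E]
    (μ₁ μ₂ : Measure E) [IsProbabilityMeasure μ₁] [IsProbabilityMeasure μ₂]
    {C : Set E} (hC : MeasurableSet C) (h1 : μ₁ C = 1) (h2 : μ₂ C = 0)
    {δ : ℝ≥0∞} (hδ : 0 < δ) :
    ∃ (D₁ D₂ : Set E) (ε : ℝ), 0 < ε ∧ MeasurableSet D₁ ∧ MeasurableSet D₂ ∧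
      μ₁ D₁ ≤ δ ∧ μ₂ D₂ ≤ δ ∧ ∀ a b, dist a b ≤ ε → a ∈ D₁ ∨ b ∈ D₂ := by
  obtain ⟨B, hBC, hBcl, hB⟩ := hC.compl.exists_isClosed_sdiff_lt (measure_ne_top μ₂ _) hδ.ne'
  have hμB : μ₁ B = 0 := measure_mono_null hBC ((prob_compl_eq_zero_iff hC).2 h1)
  have ht := tendsto_measure_cthickening_of_isClosed (μ := μ₁) (s := B)
    ⟨1, one_pos, measure_ne_top _ _⟩ hBcl
  rw [hμB] at ht
  have hev : ∀ᶠ r in nhdsWithin (0 : ℝ) (Set.Ioi 0), μ₁ (Metric.cthickening r B) < δ :=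
    (ht.mono_left nhdsWithin_le_nhds).eventually (gt_mem_nhds hδ)
  obtain ⟨r, hr, hr0⟩ := (hev.and self_mem_nhdsWithin).exists
  refine ⟨Metric.cthickening r B, Bᶜ, r, hr0, Metric.isClosed_cthickening.measurableSet,
    hBcl.measurableSet.compl, hr.le, ?_, ?_⟩
  · have : Bᶜ ⊆ C ∪ (Cᶜ \ B) := by
      intro x hx
      by_cases h : x ∈ C
      · exact Or.inl h
      · exact Or.inr ⟨h, hx⟩
    calc μ₂ Bᶜ ≤ μ₂ C + μ₂ (Cᶜ \ B) := (measure_mono this).trans (measure_union_le _ _)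
      _ ≤ δ := by rw [h2, zero_add]; exact hB.le
  · intro a b hab
    by_cases hb : b ∈ B
    · exact Or.inl (Metric.mem_cthickening_of_dist_le a b r B hb hab)
    · exact Or.inr hb

lemma limsup_le_of_not_bad {E : Type*} [MetricSpace E] [MeasurableSpace E]
    {D₁ D₂ : Set E} {ε c : ℝ} (hsep : ∀ a b, dist a b ≤ ε → a ∈ D₁ ∨ b ∈ D₂)
    {ω₁ ω₂ : ℕ → E} (h1 : ω₁ ∉ badTraj D₁ c) (h2 : ω₂ ∉ badTraj D₂ c) :
    limsup (fun n : ℕ => (∑ i ∈ Finset.range n,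
      if dist (ω₁ i) (ω₂ i) ≤ ε then (1 : ℝ) else 0) / n) atTop ≤ 2 * c := by
  simp only [badTraj, Set.mem_ofPred_eq, not_forall, not_exists, not_lt] at h1 h2
  obtain ⟨K₁, hK₁⟩ := h1
  obtain ⟨K₂, hK₂⟩ := h2
  have hbound : ∀ n : ℕ, 0 < n → (∑ i ∈ Finset.range n,
      if dist (ω₁ i) (ω₂ i) ≤ ε then (1 : ℝ) else 0) / n ≤ 2 * c + (K₁ + K₂) / n := by
    intro n hn
    have hn' : (0 : ℝ) < n := Nat.cast_pos.2 hn
    have : (∑ i ∈ Finset.range n, if dist (ω₁ i) (ω₂ i) ≤ ε then (1 : ℝ) else 0) ≤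
        visits D₁ n ω₁ + visits D₂ n ω₂ := by
      unfold visits
      rw [← Finset.sum_add_distrib]
      refine Finset.sum_le_sum fun i _ => ?_
      have a1 := ind_nonneg D₁ (ω₁ i)
      have a2 := ind_nonneg D₂ (ω₂ i)
      split_ifs with h
      · rcases hsep _ _ h with h | h
        · rw [Set.indicator_of_mem h]; linarith
        · rw [Set.indicator_of_mem h]; linarith
      · linarith
    rw [div_le_iff₀ hn', add_mul, div_mul_cancel₀ _ hn'.ne']
    linarith [hK₁ n, hK₂ n]
  have hlim : Tendsto (fun n : ℕ => 2 * c + ((K₁ : ℝ) + K₂) / n) atTop (nhds (2 * c)) := by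
    simpa using (tendsto_const_div_atTop_nhds_zero_nat ((K₁ : ℝ) + K₂)).const_add (2 * c)
  rw [← hlim.limsup_eq]
  refine limsup_le_limsup ((eventually_gt_atTop 0).mono hbound) ?_ hlim.isBoundedUnder_le
  refine IsCoboundedUnder.of_frequently_ge (a := 0) (Frequently.of_forall fun n => ?_)
  exact div_nonneg (Finset.sum_nonneg fun i _ => by split_ifs <;> norm_num) (Nat.cast_nonneg n)

/-- Theorem `main`, metric case: if for `μ₁ ⊗ μ₂`-positively many pairs `(x,y)`
there are generalized couplings under which the two trajectories are within
distance `ε` of each other with positive limiting frequency (with positive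
outer probability), then the invariant probability measures `μ₁` and `μ₂`
cannot be mutually singular. (A measure in Lean, applied to an arbitrary set,
is by definition the associated outer measure of that set.) -/
theorem invariant_measures_not_singular_of_generalized_couplings
    {E : Type*} [MetricSpace E] [MeasurableSpace E] [BorelSpace E]
    (P : Kernel E E) [IsMarkovKernel P]
    (μ₁ μ₂ : Measure E) [IsProbabilityMeasure μ₁] [IsProbabilityMeasure μ₂]
    (h₁ : IsInvariantMeasure P μ₁) (h₂ : IsInvariantMeasure P μ₂)
    (ℙP : E → Measure (ℕ → E)) (hℙ : IsChainLaw P ℙP)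
    (M : Set (E × E)) (hM : MeasurableSet M) (hMpos : 0 < (μ₁.prod μ₂) M)
    (hcoup : ∀ x y : E, (x, y) ∈ M → ∃ α > (0 : ℝ), ∀ ε > (0 : ℝ),
      ∃ ξ : Measure ((ℕ → E) × (ℕ → E)), IsGeneralizedCoupling ξ (ℙP x) (ℙP y) ∧
        0 < ξ {p : (ℕ → E) × (ℕ → E) | α ≤ limsup (fun n : ℕ =>
          (∑ i ∈ Finset.range n,
            if dist (p.1 i) (p.2 i) ≤ ε then (1 : ℝ) else 0) / n) atTop}) :
    ¬ ∃ C : Set E, MeasurableSet C ∧ μ₁ C = 1 ∧ μ₂ C = 0 := by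
  rintro ⟨C, hC, hC1, hC2⟩
  choose D₁ D₂ ε hε hD₁ hD₂ hμ1 hμ2 hsep using fun k : ℕ =>
    exists_separation μ₁ μ₂ hC hC1 hC2 (δ := ENNReal.ofReal ((1 / 4) ^ k))
      (ENNReal.ofReal_pos.2 (by positivity))
  have ae1 := Measure.quasiMeasurePreserving_fst (μ := μ₁) (ν := μ₂) |>.ae
    (chainLaw_ae_eventually hℙ h₁ hD₁ hμ1)
  have ae2 := Measure.quasiMeasurePreserving_snd (μ := μ₁) (ν := μ₂) |>.ae
    (chainLaw_ae_eventually hℙ h₂ hD₂ hμ2)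
  have hfreq : ∃ᵐ p ∂(μ₁.prod μ₂), p ∈ M := by
    rw [frequently_ae_mem_iff]
    exact hMpos.ne'
  obtain ⟨⟨x, y⟩, hxy, hx, hy⟩ := (hfreq.and_eventually (ae1.and ae2)).exists
  obtain ⟨α, hα, hc⟩ := hcoup x y hxy
  have hsmall : ∀ᶠ k : ℕ in atTop, ((1 : ℝ) / 2) ^ k < α / 2 :=
    (tendsto_pow_atTop_nhds_zero_of_lt_one (by norm_num) (by norm_num)).eventually
      (gt_mem_nhds (by positivity))
  obtain ⟨k, hk, hxk, hyk⟩ := (hsmall.and (hx.and hy)).exists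
  obtain ⟨ξ, ⟨_, hξ1, hξ2⟩, hpos⟩ := hc (ε k) (hε k)
  refine hpos.ne' (measure_mono_null (t := Prod.fst ⁻¹' badTraj (D₁ k) ((1 / 2) ^ k) ∪
    Prod.snd ⁻¹' badTraj (D₂ k) ((1 / 2) ^ k)) ?_ (measure_union_null ?_ ?_))
  · intro p hp
    by_contra hnot
    simp only [Set.mem_union, Set.mem_preimage, not_or] at hnot
    have h := limsup_le_of_not_bad (hsep k) hnot.1 hnot.2
    have hp' := le_trans hp h
    linarith
  · rw [← Measure.map_apply measurable_fst (measurableSet_badTraj (hD₁ k) _)]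
    exact hξ1 hxk
  · rw [← Measure.map_apply measurable_snd (measurableSet_badTraj (hD₂ k) _)]
    exact hξ2 hyk
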